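/- Let x, y : [t₀−r, t₁] → ℝⁿ be two solutions of the retarded functional differential equation ẋ(t) = f(t, T_r(t)x, d(t)) on [t₀, t₁] corresponding to the same d ∈ M_D (i.e. both are continuous on [t₀−r, t₁], absolutely continuous on [t₀, t₁], and satisfy the equation almost everywhere on [t₀, t₁]). Set a := sup_{s∈[t₀−r,t₁]} |x(s)| + sup_{s∈[t₀−r,t₁]} |y(s)|. Then for every t ∈ [t₀, t₁]: ‖T_r(t)x − T_r(t)y‖_r ≤ ‖T_r(t₀)x − T_r(t₀)y‖_r · exp( L(t, a) · (t − t₀) ), where L is the function from hypothesis (H1). In particular, solutions of the initial value problem are unique. -/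

import Mathlib

open Set Filter MeasureTheory
open scoped RealInnerProductSpace

noncomputable section

/-- ℝⁿ with the Euclidean norm. -/
abbrev Euc (n : ℕ) : Type := EuclideanSpace ℝ (Fin n)

/-- The sup norm `‖y‖_q = max_{θ ∈ [-q,0]} |y θ|` of a history segment. -/
def histNorm (n : ℕ) (q : ℝ) (y : ℝ → Euc n) : ℝ :=
  sSup ((fun θ => ‖y θ‖) '' Icc (-q) 0)

/-- The class `M_D` of allowed disturbances: right-continuous maps `d : [0,∞) → D`
which are continuous outside a countable set with no finite accumulation point. -/
def MD (l : ℕ) (D : Set (Euc l)) (d : ℝ → Euc l) : Prop :=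
  (∀ t, 0 ≤ t → d t ∈ D) ∧
  (∀ t, 0 ≤ t → ∀ ε > 0, ∃ δ > 0, ∀ s, t ≤ s → s - t < δ → ‖d s - d t‖ < ε) ∧
  ∃ A : Set ℝ, (∀ C : ℝ, (A ∩ Icc 0 C).Finite) ∧
    ∀ t, 0 ≤ t → t ∉ A → ∀ ε > 0, ∃ δ > 0, ∀ s, 0 ≤ s → |s - t| < δ → ‖d s - d t‖ < ε

/-- The operator `E_h(x;v)`. -/
def Eop (n : ℕ) (x : ℝ → Euc n) (h : ℝ) (v : Euc n) : ℝ → Euc n :=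
  fun θ => if -h < θ then x 0 + (θ + h) • v else x (θ + h)

/-- The generalized (Dini-type) derivative
`V⁰(t,x;v) = limsup_{h→0⁺, y→0} (V(t+h, E_h(x;v)+h y) - V(t,x))/h` of a functional `V`
defined on `[0,∞) × C([-q,0];ℝⁿ)`, with values in the extended reals. -/
def Vdot (n : ℕ) (q : ℝ) (V : ℝ → (ℝ → Euc n) → ℝ) (t : ℝ)
    (x : ℝ → Euc n) (v : Euc n) : EReal :=
  ⨅ δ : Ioi (0:ℝ), ⨆ p : {p : ℝ × (ℝ → Euc n) //
      0 < p.1 ∧ p.1 < (δ : ℝ) ∧ ContinuousOn p.2 (Icc (-q) 0) ∧ histNorm n q p.2 < (δ : ℝ)},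
    (((V (t + p.1.1) (fun θ => Eop n x p.1.1 v θ + p.1.1 • p.1.2 θ) - V t x) / p.1.1 : ℝ) : EReal)

/-- The upper right Dini derivative `D⁺v(t) = limsup_{h→0⁺} (v(t+h)-v(t))/h`. -/
def DiniUpper (v : ℝ → ℝ) (t : ℝ) : EReal :=
  Filter.limsup (fun h => (((v (t + h) - v t) / h : ℝ) : EReal)) (nhdsWithin 0 (Ioi 0))

/-- Class `K∞` functions (on `[0,∞)`). -/
def IsKInf (a : ℝ → ℝ) : Prop :=
  ContinuousOn a (Ici 0) ∧ StrictMonoOn a (Ici 0) ∧ a 0 = 0 ∧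
  (∀ s, 0 ≤ s → 0 ≤ a s) ∧ Filter.Tendsto a Filter.atTop Filter.atTop

/-- Class `K⁺`: positive continuous functions on `[0,∞)`. -/
def IsKPlus (b : ℝ → ℝ) : Prop :=
  ContinuousOn b (Ici 0) ∧ ∀ t, 0 ≤ t → 0 < b t

/-- Class `KL` functions. -/
def IsKL (σ : ℝ → ℝ → ℝ) : Prop :=
  ContinuousOn (fun p : ℝ × ℝ => σ p.1 p.2) (Ici 0 ×ˢ Ici 0) ∧
  (∀ s t, 0 ≤ s → 0 ≤ t → 0 ≤ σ s t) ∧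
  (∀ t, 0 ≤ t → StrictMonoOn (fun s => σ s t) (Ici 0) ∧ σ 0 t = 0) ∧
  (∀ s, 0 ≤ s → AntitoneOn (σ s) (Ici 0)) ∧
  (∀ s, 0 ≤ s → Filter.Tendsto (σ s) Filter.atTop (nhds 0))

/-- Hypothesis (H1): a one-sided Lipschitz estimate. -/
def H1 (n l : ℕ) (r : ℝ) (D : Set (Euc l)) (f : ℝ → (ℝ → Euc n) → Euc l → Euc n) : Prop :=
  ∃ L : ℝ → ℝ → ℝ,
    ContinuousOn (fun p : ℝ × ℝ => L p.1 p.2) (Ici 0 ×ˢ Ici 0) ∧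
    (∀ t, 0 ≤ t → MonotoneOn (L t) (Ici 0)) ∧
    (∀ s, 0 ≤ s → MonotoneOn (fun t => L t s) (Ici 0)) ∧
    (∀ t s, 0 ≤ t → 0 ≤ s → 0 ≤ L t s) ∧
    ∀ t x y d, 0 ≤ t → ContinuousOn x (Icc (-r) 0) → ContinuousOn y (Icc (-r) 0) → d ∈ D →
      (inner ℝ (x 0 - y 0) (f t x d - f t y d) : ℝ) ≤
        L t (histNorm n r x + histNorm n r y) * (histNorm n r (x - y))^2

/-- Hypothesis (H2): `f` maps bounded sets to bounded sets, uniformly in `d ∈ D`. -/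
def H2 (n l : ℕ) (r : ℝ) (D : Set (Euc l)) (f : ℝ → (ℝ → Euc n) → Euc l → Euc n) : Prop :=
  ∀ Tb Rb : ℝ, ∃ C : ℝ, ∀ t x d, 0 ≤ t → t ≤ Tb → ContinuousOn x (Icc (-r) 0) →
    histNorm n r x ≤ Rb → d ∈ D → ‖f t x d‖ ≤ C

/-- Hypothesis (H3): continuity off a countable exceptional set of times with no finite
accumulation point, plus right-continuity in time everywhere. -/
def H3 (n l : ℕ) (r : ℝ) (D : Set (Euc l)) (f : ℝ → (ℝ → Euc n) → Euc l → Euc n) : Prop :=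
  ∃ A : Set ℝ, (∀ C : ℝ, (A ∩ Icc 0 C).Finite) ∧
    (∀ t x d, 0 ≤ t → t ∉ A → ContinuousOn x (Icc (-r) 0) → d ∈ D →
      ∀ ε > 0, ∃ δ > 0, ∀ t' x' d', 0 ≤ t' → ContinuousOn x' (Icc (-r) 0) → d' ∈ D →
        |t' - t| < δ → histNorm n r (x' - x) < δ → ‖d' - d‖ < δ →
          ‖f t' x' d' - f t x d‖ < ε) ∧
    (∀ t x d, 0 ≤ t → ContinuousOn x (Icc (-r) 0) → d ∈ D →
      ∀ ε > 0, ∃ δ > 0, ∀ t', t ≤ t' → t' - t < δ → ‖f t' x d - f t x d‖ < ε)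

/-- Hypothesis (H4). -/
def H4 (n l : ℕ) (r : ℝ) (D : Set (Euc l)) (f : ℝ → (ℝ → Euc n) → Euc l → Euc n) : Prop :=
  ∀ ε > 0, ∀ t, 0 ≤ t → ∃ δ > 0, ∀ τ x d, 0 ≤ τ → d ∈ D → ContinuousOn x (Icc (-r) 0) →
    |τ - t| + histNorm n r x < δ → ‖f τ x d‖ < ε

/-- A solution of the RFDE on `[t₀ - r, T)` (continuous, absolutely continuous on compact
subintervals of `[t₀,T)` and satisfying the equation a.e., expressed in integral form). -/
def IsSolIco (n l : ℕ) (r : ℝ) (f : ℝ → (ℝ → Euc n) → Euc l → Euc n) (d : ℝ → Euc l)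
    (t₀ T : ℝ) (x : ℝ → Euc n) : Prop :=
  ContinuousOn x (Ico (t₀ - r) T) ∧
  ∀ t ∈ Ico t₀ T,
    IntervalIntegrable (fun s => f s (fun θ => x (s + θ)) (d s)) volume t₀ t ∧
    x t = x t₀ + ∫ s in t₀..t, f s (fun θ => x (s + θ)) (d s)

/-- A solution of the RFDE on all of `[t₀ - r, ∞)`. -/
def IsSolGlobal (n l : ℕ) (r : ℝ) (f : ℝ → (ℝ → Euc n) → Euc l → Euc n) (d : ℝ → Euc l)
    (t₀ : ℝ) (x : ℝ → Euc n) : Prop :=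
  ContinuousOn x (Ici (t₀ - r)) ∧
  ∀ t, t₀ ≤ t →
    IntervalIntegrable (fun s => f s (fun θ => x (s + θ)) (d s)) volume t₀ t ∧
    x t = x t₀ + ∫ s in t₀..t, f s (fun θ => x (s + θ)) (d s)

/-- Non-uniform in time robust global asymptotic stability of `0` for the RFDE:
every maximal solution is defined on `[t₀,∞)` and satisfies the `KL` estimate (2.6). -/
def RGASnu (n l : ℕ) (r : ℝ) (D : Set (Euc l))
    (f : ℝ → (ℝ → Euc n) → Euc l → Euc n) : Prop :=
  ∃ σ : ℝ → ℝ → ℝ, ∃ β : ℝ → ℝ, IsKL σ ∧ IsKPlus β ∧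
    (∀ t₀ x₀ d, 0 ≤ t₀ → ContinuousOn x₀ (Icc (-r) 0) → MD l D d →
      ∃ x : ℝ → Euc n, IsSolGlobal n l r f d t₀ x ∧ ∀ θ ∈ Icc (-r) 0, x (t₀ + θ) = x₀ θ) ∧
    (∀ t₀ x₀ d x, 0 ≤ t₀ → ContinuousOn x₀ (Icc (-r) 0) → MD l D d →
      IsSolGlobal n l r f d t₀ x → (∀ θ ∈ Icc (-r) 0, x (t₀ + θ) = x₀ θ) →
      ∀ t, t₀ ≤ t →
        histNorm n r (fun θ => x (t + θ)) ≤ σ (β t₀ * histNorm n r x₀) (t - t₀))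

/-- Uniform robust global asymptotic stability of `0` for the RFDE. -/
def URGAS (n l : ℕ) (r : ℝ) (D : Set (Euc l))
    (f : ℝ → (ℝ → Euc n) → Euc l → Euc n) : Prop :=
  ∃ σ : ℝ → ℝ → ℝ, IsKL σ ∧
    (∀ t₀ x₀ d, 0 ≤ t₀ → ContinuousOn x₀ (Icc (-r) 0) → MD l D d →
      ∃ x : ℝ → Euc n, IsSolGlobal n l r f d t₀ x ∧ ∀ θ ∈ Icc (-r) 0, x (t₀ + θ) = x₀ θ) ∧
    (∀ t₀ x₀ d x, 0 ≤ t₀ → ContinuousOn x₀ (Icc (-r) 0) → MD l D d →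
      IsSolGlobal n l r f d t₀ x → (∀ θ ∈ Icc (-r) 0, x (t₀ + θ) = x₀ θ) →
      ∀ t, t₀ ≤ t →
        histNorm n r (fun θ => x (t + θ)) ≤ σ (histNorm n r x₀) (t - t₀))

/-- The square of a primitive `w` of an integrable function `h` is a primitive of `2 w h`. -/
lemma sq_add_integral_sub_sq {h : ℝ → ℝ} {a b : ℝ} (hh : IntervalIntegrable h volume a b)
    (c : ℝ) :
    (c + ∫ s in a..b, h s) ^ 2 - c ^ 2 = ∫ t in a..b, 2 * ((c + ∫ s in a..t, h s) * h t) := by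
  have hconst : AbsolutelyContinuousOnInterval (fun _ : ℝ => c) a b :=
    (LipschitzWith.const c).lipschitzOnWith.absolutelyContinuousOnInterval
  have hw : AbsolutelyContinuousOnInterval (fun t => c + ∫ s in a..t, h s) a b :=
    hconst.add (hh.absolutelyContinuousOnInterval_intervalIntegral (c := a) (by simp))
  have hsq := (hw.fun_mul hw).integral_deriv_eq_sub
  have hcongr : ∫ t in a..b, 2 * ((c + ∫ s in a..t, h s) * h t) =
      ∫ t in a..b, deriv (fun t => (c + ∫ s in a..t, h s) * (c + ∫ s in a..t, h s)) t := by
    apply intervalIntegral.integral_congr_ae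
    filter_upwards [hh.ae_hasDerivAt_integral] with t ht hmem
    have hd := (ht (uIoc_subset_uIcc hmem) a (by simp)).const_add c
    refine Eq.trans ?_ (hd.fun_mul hd).deriv.symm
    ring
  rw [hcongr, hsq]
  simp only [intervalIntegral.integral_same]
  ring

/-- The squared Euclidean norm of a primitive `z` of `g` is a primitive of `2 ⟪z, g⟫`. -/
lemma norm_sq_sub_norm_sq_eq_integral {n : ℕ} {z g : ℝ → Euc n} {a b : ℝ} (hab : a ≤ b)
    (hg : IntervalIntegrable g volume a b)
    (hz : ∀ t ∈ Icc a b, z t = z a + ∫ s in a..t, g s) :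
    ‖z b‖ ^ 2 - ‖z a‖ ^ 2 = ∫ t in a..b, 2 * (inner ℝ (z t) (g t) : ℝ) := by
  have hgi : ∀ i, IntervalIntegrable (fun s => g s i) volume a b := fun i =>
    ⟨(EuclideanSpace.proj i : Euc n →L[ℝ] ℝ).integrable_comp hg.1,
      (EuclideanSpace.proj i : Euc n →L[ℝ] ℝ).integrable_comp hg.2⟩
  have hzi : ∀ i, ∀ t ∈ Icc a b, z t i = z a i + ∫ s in a..t, g s i := by
    intro i t ht
    have hgt : IntervalIntegrable g volume a t := hg.mono_set (by
      rw [uIcc_of_le ht.1, uIcc_of_le hab]; exact Icc_subset_Icc_right ht.2)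
    have hcomm := (EuclideanSpace.proj i : Euc n →L[ℝ] ℝ).intervalIntegral_comp_comm hgt
    refine (congrArg (fun v : Euc n => v i) (hz t ht)).trans ?_
    exact congrArg (z a i + ·) hcomm.symm
  have hcont : ∀ i, ContinuousOn (fun t => z a i + ∫ s in a..t, g s i) (uIcc a b) := fun i =>
    continuousOn_const.add
      (((hgi i).absolutelyContinuousOnInterval_intervalIntegral (c := a) (by simp)).continuousOn)
  have hinner : ∫ t in a..b, 2 * (inner ℝ (z t) (g t) : ℝ) =
      ∫ t in a..b, ∑ i, 2 * ((z a i + ∫ s in a..t, g s i) * g t i) := by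
    apply intervalIntegral.integral_congr
    intro t ht
    rw [uIcc_of_le hab] at ht
    simp only [PiLp.inner_apply, Finset.mul_sum]
    refine Finset.sum_congr rfl fun i _ => ?_
    rw [← hzi i t ht]
    simp [mul_comm]
  rw [hinner, intervalIntegral.integral_finsetSum
    fun i _ => ((hgi i).continuousOn_mul (hcont i)).const_mul 2]
  simp only [← sq_add_integral_sub_sq (hgi _), EuclideanSpace.norm_sq_eq, Real.norm_eq_abs,
    sq_abs, Finset.sum_sub_distrib, ← hzi _ b (right_mem_Icc.2 hab)]

lemma ContinuousOn.comp_const_add_Icc {E : Type*} [TopologicalSpace E] {z : ℝ → E}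
    {r t₀ t₁ t : ℝ} (hz : ContinuousOn z (Icc (t₀ - r) t₁)) (ht : t ∈ Icc t₀ t₁) :
    ContinuousOn (fun θ => z (t + θ)) (Icc (-r) 0) :=
  hz.comp (by fun_prop) fun θ hθ => ⟨by linarith [hθ.1, ht.1], by linarith [hθ.2, ht.2]⟩

lemma norm_le_histNorm {n : ℕ} {r θ : ℝ} {z : ℝ → Euc n} (hz : ContinuousOn z (Icc (-r) 0))
    (hθ : θ ∈ Icc (-r) 0) : ‖z θ‖ ≤ histNorm n r z :=
  le_csSup (isCompact_Icc.bddAbove_image hz.norm) (mem_image_of_mem _ hθ)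

lemma histNorm_le {n : ℕ} {r C : ℝ} {z : ℝ → Euc n} (hr : 0 ≤ r)
    (hz : ∀ θ ∈ Icc (-r) 0, ‖z θ‖ ≤ C) : histNorm n r z ≤ C :=
  csSup_le ((nonempty_Icc.2 (by linarith)).image _) (forall_mem_image.2 hz)

lemma histNorm_nonneg (n : ℕ) (r : ℝ) (z : ℝ → Euc n) : 0 ≤ histNorm n r z :=
  Real.sSup_nonneg (forall_mem_image.2 fun _ _ => norm_nonneg _)

/-- A strict Gronwall estimate for the norm of a primitive `z` of `g` whose growth is controlled
by the history segments of `z`. -/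
lemma norm_lt_mul_exp_of_inner_le {n : ℕ} {r K N a b : ℝ} {z g : ℝ → Euc n}
    (hr : 0 ≤ r) (hab : a ≤ b) (hK : 0 ≤ K)
    (hzc : ContinuousOn z (Icc (a - r) b)) (hg : IntervalIntegrable g volume a b)
    (hz : ∀ t ∈ Icc a b, z t = z a + ∫ s in a..t, g s)
    (hinner : ∀ s ∈ Icc a b,
      (inner ℝ (z s) (g s) : ℝ) ≤ K * histNorm n r (fun θ => z (s + θ)) ^ 2)
    (hN : histNorm n r (fun θ => z (a + θ)) < N) :
    ∀ s ∈ Icc a b, ‖z s‖ < N * Real.exp (K * (s - a)) := by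
  have hzI : ContinuousOn z (Icc a b) := hzc.mono (Icc_subset_Icc_left (by linarith))
  have hN0 : 0 < N := (histNorm_nonneg ..).trans_lt hN
  have hpast : ∀ u ∈ Icc (a - r) a, ‖z u‖ < N := by
    intro u hu
    have := norm_le_histNorm (hzc.comp_const_add_Icc (left_mem_Icc.2 hab))
      (θ := u - a) ⟨by linarith [hu.1], by linarith [hu.2]⟩
    rw [add_sub_cancel] at this
    exact this.trans_lt hN
  by_contra! hcon
  set ψ : ℝ → ℝ := fun s => N * Real.exp (K * (s - a)) with hψ
  have hψc : Continuous ψ := by fun_prop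
  have hψmono : Monotone ψ := fun u v huv => by
    simp only [hψ]
    gcongr
  have hψa : ψ a = N := by simp [hψ]
  have hψpos : ∀ s, 0 < ψ s := fun s => by simp only [hψ]; positivity
  have hclosed : IsClosed (Icc a b ∩ {s | ψ s ≤ ‖z s‖}) := by
    have := (hzI.norm.sub hψc.continuousOn).preimage_isClosed_of_isClosed isClosed_Icc
      (isClosed_Ici (a := (0 : ℝ)))
    simpa [preimage, ofPred_inter_eq_sep] using this
  obtain ⟨τ, ⟨hτ, hτle⟩, hmin⟩ :=
    (isCompact_Icc.of_isClosed_subset hclosed inter_subset_left).exists_isLeast hcon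
  have hbefore : ∀ u ∈ Ico (a - r) τ, ‖z u‖ ≤ ψ (max u a) := by
    intro u hu
    rcases le_total u a with hua | hau
    · rw [max_eq_right hua, hψa]
      exact (hpast u ⟨hu.1, hua⟩).le
    · rw [max_eq_left hau]
      by_contra! hlt
      exact hu.2.not_ge (hmin ⟨⟨hau, hu.2.le.trans hτ.2⟩, hlt.le⟩)
  have hgτ : IntervalIntegrable g volume a τ := hg.mono_set (by
    rw [uIcc_of_le hτ.1, uIcc_of_le hab]; exact Icc_subset_Icc_right hτ.2)
  have hzτ := norm_sq_sub_norm_sq_eq_integral hτ.1 hgτ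
    fun t ht => hz t ⟨ht.1, ht.2.trans hτ.2⟩
  have hderiv : ∀ s ∈ uIcc a τ, HasDerivAt (fun s => ψ s ^ 2) (2 * (K * ψ s ^ 2)) s := by
    intro s _
    have h1 : HasDerivAt ψ (N * (Real.exp (K * (s - a)) * (K * 1))) s :=
      ((((hasDerivAt_id s).sub_const a).const_mul K).exp).const_mul N
    refine (h1.fun_pow 2).congr_deriv ?_
    simp only [hψ]
    push_cast
    ring
  have hint : IntervalIntegrable (fun s => 2 * (K * ψ s ^ 2)) volume a τ :=
    Continuous.intervalIntegrable (by fun_prop) _ _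
  have hψint := intervalIntegral.integral_eq_sub_of_hasDerivAt hderiv hint
  have hzgint : IntervalIntegrable (fun t => 2 * (inner ℝ (z t) (g t) : ℝ)) volume a τ := by
    have hzτc : ContinuousOn z (uIcc a τ) := by
      rw [uIcc_of_le hτ.1]
      exact hzI.mono (Icc_subset_Icc_right hτ.2)
    simp only [PiLp.inner_apply]
    refine IntervalIntegrable.const_mul ?_ 2
    simp only [← Finset.sum_fn]
    refine IntervalIntegrable.sum _ fun i _ => ?_
    have hgi : IntervalIntegrable (fun s => g s i) volume a τ :=
      ⟨(EuclideanSpace.proj i : Euc n →L[ℝ] ℝ).integrable_comp hgτ.1,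
        (EuclideanSpace.proj i : Euc n →L[ℝ] ℝ).integrable_comp hgτ.2⟩
    exact hgi.mul_continuousOn
      ((EuclideanSpace.proj i : Euc n →L[ℝ] ℝ).continuous.comp_continuousOn hzτc)
  have hmono : ∫ t in a..τ, 2 * (inner ℝ (z t) (g t) : ℝ) ≤ ∫ s in a..τ, 2 * (K * ψ s ^ 2) := by
    refine intervalIntegral.integral_mono_on_of_le_Ioo hτ.1 hzgint hint fun s hs => ?_
    have hhist : histNorm n r (fun θ => z (s + θ)) ≤ ψ s :=
      histNorm_le hr fun θ hθ =>
        (hbefore (s + θ) ⟨by linarith [hs.1, hθ.1], by linarith [hs.2, hθ.2]⟩).trans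
          (hψmono (max_le (by linarith [hθ.2]) hs.1.le))
    have hs' := hinner s ⟨hs.1.le, hs.2.le.trans hτ.2⟩
    have hnn := histNorm_nonneg n r (fun θ => z (s + θ))
    have : K * histNorm n r (fun θ => z (s + θ)) ^ 2 ≤ K * ψ s ^ 2 := by gcongr
    linarith
  have hza : ‖z a‖ ^ 2 < N ^ 2 := by
    have := hpast a ⟨by linarith, le_rfl⟩
    gcongr
  have hτsq : ψ τ ^ 2 ≤ ‖z τ‖ ^ 2 := by
    have := (hψpos τ).le
    have h2 : ψ τ ≤ ‖z τ‖ := hτle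
    gcongr
  rw [hψint, ← hzτ, hψa] at hmono
  linarith

/-- Gronwall estimate for the history segments of `z`. -/
lemma histNorm_le_mul_exp_of_inner_le {n : ℕ} {r K a b : ℝ} {z g : ℝ → Euc n}
    (hr : 0 ≤ r) (hab : a ≤ b) (hK : 0 ≤ K)
    (hzc : ContinuousOn z (Icc (a - r) b)) (hg : IntervalIntegrable g volume a b)
    (hz : ∀ t ∈ Icc a b, z t = z a + ∫ s in a..t, g s)
    (hinner : ∀ s ∈ Icc a b,
      (inner ℝ (z s) (g s) : ℝ) ≤ K * histNorm n r (fun θ => z (s + θ)) ^ 2) :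
    histNorm n r (fun θ => z (b + θ)) ≤
      histNorm n r (fun θ => z (a + θ)) * Real.exp (K * (b - a)) := by
  rw [← div_le_iff₀ (Real.exp_pos _)]
  refine le_of_forall_gt_imp_ge_of_dense fun N hN => ?_
  rw [div_le_iff₀ (Real.exp_pos _)]
  have hN0 : 0 ≤ N := (histNorm_nonneg ..).trans hN.le
  refine histNorm_le hr fun θ hθ => ?_
  rcases le_total a (b + θ) with hle | hle
  · refine (norm_lt_mul_exp_of_inner_le hr hab hK hzc hg hz hinner hN (b + θ)
      ⟨hle, by linarith [hθ.2]⟩).le.trans ?_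
    gcongr
    linarith [hθ.2]
  · have hpast := norm_le_histNorm (hzc.comp_const_add_Icc (left_mem_Icc.2 hab))
      (θ := b + θ - a) ⟨by linarith [hθ.1], by linarith⟩
    rw [add_sub_cancel] at hpast
    refine (hpast.trans hN.le).trans (le_mul_of_one_le_right hN0 (Real.one_le_exp ?_))
    exact mul_nonneg hK (by linarith)

/-- If `x, y` are two solutions of the RFDE
`ẋ(t) = f(t, T_r(t)x, d(t))` on `[t₀, t₁]` (continuous on `[t₀-r,t₁]`, absolutely
continuous on `[t₀,t₁]`, satisfying the equation a.e., here in integral form)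
corresponding to the same `d ∈ M_D`, and `a` is the sum of the sup norms of `x` and `y`
over `[t₀-r,t₁]`, then
`‖T_r(t)x - T_r(t)y‖_r ≤ ‖T_r(t₀)x - T_r(t₀)y‖_r ⬝ exp(L(t,a)(t-t₀))` for `t ∈ [t₀,t₁]`;
in particular solutions of the initial value problem are unique. -/
theorem stmt0 (n l : ℕ) (r : ℝ) (hr : 0 ≤ r) (D : Set (Euc l)) (hD : D.Nonempty)
    (f : ℝ → (ℝ → Euc n) → Euc l → Euc n)
    (L : ℝ → ℝ → ℝ)
    (hLc : ContinuousOn (fun p : ℝ × ℝ => L p.1 p.2) (Ici 0 ×ˢ Ici 0))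
    (hLmono1 : ∀ t, 0 ≤ t → MonotoneOn (L t) (Ici 0))
    (hLmono2 : ∀ s, 0 ≤ s → MonotoneOn (fun t => L t s) (Ici 0))
    (hLnn : ∀ t s, 0 ≤ t → 0 ≤ s → 0 ≤ L t s)
    (hH1 : ∀ t x y d, 0 ≤ t → ContinuousOn x (Icc (-r) 0) → ContinuousOn y (Icc (-r) 0) →
      d ∈ D → (inner ℝ (x 0 - y 0) (f t x d - f t y d) : ℝ) ≤
        L t (histNorm n r x + histNorm n r y) * (histNorm n r (x - y))^2)
    (d : ℝ → Euc l) (hd : MD l D d)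
    (t₀ t₁ : ℝ) (ht₀ : 0 ≤ t₀) (ht₀₁ : t₀ ≤ t₁)
    (x y : ℝ → Euc n)
    (hxc : ContinuousOn x (Icc (t₀ - r) t₁))
    (hyc : ContinuousOn y (Icc (t₀ - r) t₁))
    (hxsol : ∀ t ∈ Icc t₀ t₁,
      IntervalIntegrable (fun s => f s (fun θ => x (s + θ)) (d s)) volume t₀ t ∧
      x t = x t₀ + ∫ s in t₀..t, f s (fun θ => x (s + θ)) (d s))
    (hysol : ∀ t ∈ Icc t₀ t₁,
      IntervalIntegrable (fun s => f s (fun θ => y (s + θ)) (d s)) volume t₀ t ∧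
      y t = y t₀ + ∫ s in t₀..t, f s (fun θ => y (s + θ)) (d s)) :
    (∀ t ∈ Icc t₀ t₁,
      histNorm n r (fun θ => x (t + θ) - y (t + θ)) ≤
        histNorm n r (fun θ => x (t₀ + θ) - y (t₀ + θ)) *
          Real.exp (L t (sSup ((fun s => ‖x s‖) '' Icc (t₀ - r) t₁) +
                         sSup ((fun s => ‖y s‖) '' Icc (t₀ - r) t₁)) * (t - t₀))) ∧
    ((∀ θ ∈ Icc (-r) 0, x (t₀ + θ) = y (t₀ + θ)) → ∀ t ∈ Icc t₀ t₁, x t = y t) := by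
  have hest : ∀ t ∈ Icc t₀ t₁,
      histNorm n r (fun θ => x (t + θ) - y (t + θ)) ≤
        histNorm n r (fun θ => x (t₀ + θ) - y (t₀ + θ)) *
          Real.exp (L t (sSup ((fun s => ‖x s‖) '' Icc (t₀ - r) t₁) +
                         sSup ((fun s => ‖y s‖) '' Icc (t₀ - r) t₁)) * (t - t₀)) := by
    intro t ht
    have hsup : ∀ w : ℝ → Euc n, ContinuousOn w (Icc (t₀ - r) t₁) → ∀ s ∈ Icc t₀ t₁,
        histNorm n r (fun θ => w (s + θ)) ≤ sSup ((fun s => ‖w s‖) '' Icc (t₀ - r) t₁) :=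
      fun w hw s hs => histNorm_le hr fun θ hθ =>
        le_csSup (isCompact_Icc.bddAbove_image hw.norm)
          (mem_image_of_mem (fun s => ‖w s‖)
            ⟨by linarith [hs.1, hθ.1], by linarith [hs.2, hθ.2]⟩)
    have hsup_nonneg : ∀ w : ℝ → Euc n,
        0 ≤ sSup ((fun s => ‖w s‖) '' Icc (t₀ - r) t₁) := fun w =>
      Real.sSup_nonneg (forall_mem_image.2 fun _ _ => norm_nonneg _)
    have ht_nonneg : 0 ≤ t := ht₀.trans ht.1
    have ha := add_nonneg (hsup_nonneg x) (hsup_nonneg y)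
    refine histNorm_le_mul_exp_of_inner_le (z := fun s => x s - y s)
      (g := fun s => f s (fun θ => x (s + θ)) (d s) - f s (fun θ => y (s + θ)) (d s))
      hr ht.1 (hLnn _ _ ht_nonneg ha)
      ((hxc.sub hyc).mono (Icc_subset_Icc_right ht.2))
      ((hxsol t ht).1.sub (hysol t ht).1) ?_ ?_
    · intro s hs
      have hs' : s ∈ Icc t₀ t₁ := ⟨hs.1, hs.2.trans ht.2⟩
      have hx := hxsol s hs'
      have hy := hysol s hs'
      simp only [intervalIntegral.integral_sub hx.1 hy.1]
      rw [hx.2, hy.2]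
      abel
    · intro s hs
      have hs' : s ∈ Icc t₀ t₁ := ⟨hs.1, hs.2.trans ht.2⟩
      have hs_nonneg : 0 ≤ s := ht₀.trans hs.1
      have hone := hH1 s (fun θ => x (s + θ)) (fun θ => y (s + θ)) (d s) hs_nonneg
        (hxc.comp_const_add_Icc hs') (hyc.comp_const_add_Icc hs') (hd.1 s hs_nonneg)
      simp only [add_zero] at hone
      refine hone.trans (mul_le_mul_of_nonneg_right ?_ (sq_nonneg _))
      exact (hLmono1 s hs_nonneg (add_nonneg (histNorm_nonneg ..) (histNorm_nonneg ..)) ha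
        (add_le_add (hsup x hxc s hs') (hsup y hyc s hs'))).trans
        (hLmono2 _ ha hs_nonneg ht_nonneg hs.2)
  refine ⟨hest, fun hinit t ht => ?_⟩
  have hzero : histNorm n r (fun θ => x (t₀ + θ) - y (t₀ + θ)) ≤ 0 :=
    histNorm_le hr fun θ hθ => by simp [hinit θ hθ]
  have hle := norm_le_histNorm ((hxc.sub hyc).comp_const_add_Icc ht)
    (θ := 0) ⟨by linarith, le_rfl⟩
  simp only [add_zero] at hle
  have := hle.trans ((hest t ht).trans
    (mul_nonpos_of_nonpos_of_nonneg hzero (Real.exp_pos _).le))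
  exact sub_eq_zero.1 (norm_le_zero_iff.1 this)
end
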